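/- Let S and B be independent real-valued random variables on a common probability space with S ~ N(0, σ_s²) and B ~ N(0, σ_b²) (centered real Gaussian laws with variances σ_s² > 0 and σ_b² > 0), and let Y := S + B. Then E[S | σ(Y)] = (σ_s²/(σ_s² + σ_b²))·Y almost surely. -/

import Mathlib

open MeasureTheory ProbabilityTheory

/-- The linear regression of `X` on `Y` when `(X, Y)` is jointly Gaussian and `X - c * Y` is
uncorrelated with `Y`. -/
lemma ProbabilityTheory.HasGaussianLaw.condExp_ae_eq_of_covariance_sub_eq_zero
    {Ω : Type*} [MeasurableSpace Ω] {μ : Measure Ω} [IsProbabilityMeasure μ]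
    {X Y : Ω → ℝ} (hX : Measurable X) (hY : Measurable Y)
    (hXY : HasGaussianLaw (fun ω ↦ (X ω, Y ω)) μ) {c : ℝ}
    (hc : cov[fun ω ↦ X ω - c * Y ω, Y; μ] = 0) :
    μ[X | MeasurableSpace.comap Y inferInstance]
      =ᵐ[μ] fun ω ↦ c * Y ω + ∫ ω, (X ω - c * Y ω) ∂μ := by
  set Z : Ω → ℝ := fun ω ↦ X ω - c * Y ω
  have hZ : Measurable Z := by fun_prop
  have hZY : HasGaussianLaw (fun ω ↦ (Z ω, Y ω)) μ :=
    hXY.map_fun (((ContinuousLinearMap.fst ℝ ℝ ℝ) - c • ContinuousLinearMap.snd ℝ ℝ ℝ).prod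
      (ContinuousLinearMap.snd ℝ ℝ ℝ))
  have hle : MeasurableSpace.comap Y inferInstance ≤ (inferInstance : MeasurableSpace Ω) :=
    hY.comap_le
  have hindep : IndepFun Z Y μ := hZY.indepFun_of_covariance_eq_zero hc
  have hZcond : μ[Z | MeasurableSpace.comap Y inferInstance] =ᵐ[μ] fun _ ↦ ∫ ω, Z ω ∂μ :=
    condExp_indep_eq hZ.comap_le hle (comap_measurable Z).stronglyMeasurable hindep
  have hcY : Integrable (fun ω ↦ c * Y ω) μ := hXY.snd.integrable.const_mul c
  have hYcond : μ[fun ω ↦ c * Y ω | MeasurableSpace.comap Y inferInstance] = fun ω ↦ c * Y ω :=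
    condExp_of_stronglyMeasurable hle
      ((comap_measurable Y).const_mul c).stronglyMeasurable hcY
  have hsum : X = (fun ω ↦ c * Y ω) + Z := by
    ext ω
    simp [Z]
  have hadd := condExp_add hcY hZY.fst.integrable (MeasurableSpace.comap Y inferInstance)
  rw [← hsum, hYcond] at hadd
  filter_upwards [hadd, hZcond] with ω h₁ h₂
  rw [h₁, Pi.add_apply, h₂]

/-- For independent centered real Gaussians `S ~ N(0, σₛ²)` and `B ~ N(0, σᵦ²)` and
`Y = S + B`, the conditional expectation satisfies
`E[S | σ(Y)] = (σₛ²/(σₛ² + σᵦ²)) Y` almost surely. -/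
theorem scalar_gaussian_mmse
    {Ω : Type*} [MeasurableSpace Ω] (μ : Measure Ω) [IsProbabilityMeasure μ]
    (S B : Ω → ℝ) (hSmeas : Measurable S) (hBmeas : Measurable B)
    (vs vb : NNReal) (hvs : 0 < vs) (hvb : 0 < vb)
    (hSlaw : Measure.map S μ = gaussianReal 0 vs)
    (hBlaw : Measure.map B μ = gaussianReal 0 vb)
    (hindep : IndepFun S B μ)
    (Y : Ω → ℝ) (hY : ∀ ω, Y ω = S ω + B ω) :
    μ[S | MeasurableSpace.comap Y inferInstance]
      =ᵐ[μ] fun ω => ((vs : ℝ) / ((vs : ℝ) + (vb : ℝ))) * Y ω := by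
  obtain rfl : Y = S + B := funext hY
  have hS : HasLaw S (gaussianReal 0 vs) μ := ⟨hSmeas.aemeasurable, hSlaw⟩
  have hB : HasLaw B (gaussianReal 0 vb) μ := ⟨hBmeas.aemeasurable, hBlaw⟩
  have hSB : HasGaussianLaw (fun ω ↦ (S ω, B ω)) μ :=
    hindep.hasGaussianLaw hS.hasGaussianLaw hB.hasGaussianLaw
  have hSY : HasGaussianLaw (fun ω ↦ (S ω, (S + B) ω)) μ :=
    hSB.map_fun ((ContinuousLinearMap.fst ℝ ℝ ℝ).prod
      (ContinuousLinearMap.fst ℝ ℝ ℝ + ContinuousLinearMap.snd ℝ ℝ ℝ))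
  have hS2 : MemLp S 2 μ := hSB.fst.memLp_two
  have hB2 : MemLp B 2 μ := hSB.snd.memLp_two
  have hSvar : cov[S, S; μ] = vs := by
    rw [covariance_self hSmeas.aemeasurable, hS.variance_eq, variance_id_gaussianReal]
  have hBvar : cov[B, B; μ] = vb := by
    rw [covariance_self hBmeas.aemeasurable, hB.variance_eq, variance_id_gaussianReal]
  have hcovSB : cov[S, B; μ] = 0 := hindep.covariance_eq_zero hS2 hB2
  have hcov : cov[fun ω ↦ S ω - ((vs : ℝ) / (vs + vb)) * (S + B) ω, S + B; μ] = 0 := by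
    have hpos : (vs : ℝ) + vb ≠ 0 := by positivity
    rw [covariance_fun_sub_left hS2 ((hS2.add hB2).const_mul _) (hS2.add hB2),
      covariance_const_mul_left, covariance_add_left hS2 hB2 (hS2.add hB2),
      covariance_add_right hS2 hS2 hB2, covariance_add_right hB2 hS2 hB2,
      covariance_comm B S, hSvar, hBvar, hcovSB]
    field_simp
    ring
  have hSmean : ∫ ω, S ω ∂μ = 0 := by rw [hS.integral_eq, integral_id_gaussianReal]
  have hBmean : ∫ ω, B ω ∂μ = 0 := by rw [hB.integral_eq, integral_id_gaussianReal]
  have hmean : ∫ ω, (S ω - ((vs : ℝ) / (vs + vb)) * (S + B) ω) ∂μ = 0 := by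
    rw [integral_sub hSB.fst.integrable (hSY.snd.integrable.const_mul _), integral_const_mul,
      integral_add' hSB.fst.integrable hSB.snd.integrable, hSmean, hBmean]
    simp
  simpa only [hmean, add_zero] using
    hSY.condExp_ae_eq_of_covariance_sub_eq_zero hSmeas (hSmeas.add hBmeas) hcov
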